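/- Pinching inequality: let A be a Hermitian d×d complex matrix with exactly ν_A distinct eigenvalues, and let B be a positive semidefinite d×d complex matrix. Then B ≤ ν_A · ℰ_A(B) in the Löwner order, where ℰ_A is the pinching map with respect to A. -/

import Mathlib

open Matrix BigOperators
open scoped ComplexOrder

noncomputable section

variable {n : Type*} [Fintype n] [DecidableEq n]

/-- Real power with the convention `0 ^ r = 0`. -/
def rpow0 (x r : ℝ) : ℝ := if x = 0 then 0 else Real.rpow x r

/-- Matrix power by the spectral functional calculus (with `0 ^ r = 0` on the kernel),
for Hermitian matrices; junk value `0` otherwise. -/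
def matPow (M : Matrix n n ℂ) (r : ℝ) : Matrix n n ℂ :=
  if h : M.IsHermitian then
    (h.eigenvectorUnitary : Matrix n n ℂ) *
      Matrix.diagonal (fun i => (rpow0 (h.eigenvalues i) r : ℂ)) *
      star (h.eigenvectorUnitary : Matrix n n ℂ)
  else 0

/-- A density matrix: positive semidefinite with unit trace. -/
def IsDensityMatrix (M : Matrix n n ℂ) : Prop := M.PosSemidef ∧ M.trace = 1

/-- Number of distinct eigenvalues of a Hermitian matrix (junk value `0` otherwise). -/
def nEig (M : Matrix n n ℂ) : ℕ :=
  if h : M.IsHermitian then (Finset.univ.image h.eigenvalues).card else 0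

/-- The spectral projection of a Hermitian matrix onto the eigenspace of `t`. -/
def spectralProj (M : Matrix n n ℂ) (h : M.IsHermitian) (t : ℝ) : Matrix n n ℂ :=
  (h.eigenvectorUnitary : Matrix n n ℂ) *
    Matrix.diagonal (fun i => if h.eigenvalues i = t then (1 : ℂ) else 0) *
    star (h.eigenvectorUnitary : Matrix n n ℂ)

/-- The pinching map with respect to a Hermitian matrix `A`:
`ℰ_A(B) = ∑_λ P_λ B P_λ` over the distinct eigenvalues `λ` of `A`. -/
def pinch (A B : Matrix n n ℂ) : Matrix n n ℂ :=
  if h : A.IsHermitian then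
    ∑ t ∈ Finset.univ.image h.eigenvalues,
      spectralProj A h t * B * spectralProj A h t
  else B

/-- The spectral projection of a Hermitian matrix onto its nonnegative eigenvalues,
`Π = ∑_{λ ≥ 0} P_λ` (junk value `0` for non-Hermitian matrices). -/
def posProj (M : Matrix n n ℂ) : Matrix n n ℂ :=
  if h : M.IsHermitian then
    (h.eigenvectorUnitary : Matrix n n ℂ) *
      Matrix.diagonal (fun i => if 0 ≤ h.eigenvalues i then (1 : ℂ) else 0) *
      star (h.eigenvectorUnitary : Matrix n n ℂ)
  else 0

/-- The sandwiched Rényi divergence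
`D̃_α(ρ‖σ) = (1/(α−1)) log₂ Tr[(σ^{(1−α)/(2α)} ρ σ^{(1−α)/(2α)})^α]`. -/
def sandwichedRenyi (α : ℝ) (ρ σ : Matrix n n ℂ) : ℝ :=
  (1 / (α - 1)) *
    Real.logb 2
      ((matPow (matPow σ ((1 - α) / (2 * α)) * ρ * matPow σ ((1 - α) / (2 * α))) α).trace.re)

/-- Fidelity `F(ρ,σ) = Tr[(σ^{1/2} ρ σ^{1/2})^{1/2}]`. -/
def fidelity (ρ σ : Matrix n n ℂ) : ℝ :=
  (matPow (matPow σ (1/2) * ρ * matPow σ (1/2)) (1/2)).trace.re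

/-- Purified distance `P(ρ,σ) = √(1 − F(ρ,σ)²)`. -/
def purifiedDist (ρ σ : Matrix n n ℂ) : ℝ :=
  Real.sqrt (1 - (fidelity ρ σ) ^ 2)

/-- Base-two matrix logarithm by spectral functional calculus (`0 ↦ 0` on the kernel). -/
def matLog2 (M : Matrix n n ℂ) : Matrix n n ℂ :=
  if h : M.IsHermitian then
    (h.eigenvectorUnitary : Matrix n n ℂ) *
      Matrix.diagonal (fun i => (Real.logb 2 (h.eigenvalues i) : ℂ)) *
      star (h.eigenvectorUnitary : Matrix n n ℂ)
  else 0

/-- Quantum relative entropy `D(ρ‖σ) = Tr[ρ (log₂ ρ − log₂ σ)]`. -/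
def relEntropy (ρ σ : Matrix n n ℂ) : ℝ :=
  (ρ * (matLog2 ρ - matLog2 σ)).trace.re


end

/-- The operator Cauchy–Schwarz inequality
`(∑ Mᵢ)ᴴ B (∑ Mᵢ) ≤ |s| ∑ Mᵢᴴ B Mᵢ` for positive semidefinite `B`. -/
theorem Matrix.PosSemidef.card_smul_sum_conj_sub_conj_sum {ι m n : Type*}
    [Fintype m] [Fintype n] {B : Matrix m m ℂ} (hB : B.PosSemidef)
    (s : Finset ι) (M : ι → Matrix m n ℂ) :
    ((s.card : ℂ) • ∑ i ∈ s, (M i)ᴴ * B * M i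
      - (∑ i ∈ s, M i)ᴴ * B * ∑ i ∈ s, M i).PosSemidef := by
  have key : (s.card : ℂ) • ∑ i ∈ s, (M i)ᴴ * B * M i
      - (∑ i ∈ s, M i)ᴴ * B * ∑ i ∈ s, M i
      = (1 / 2 : ℂ) • ∑ i ∈ s, ∑ j ∈ s, (M i - M j)ᴴ * B * (M i - M j) := by
    simp only [conjTranspose_sub, Matrix.sub_mul, Matrix.mul_sub, Finset.sum_sub_distrib,
      Finset.sum_const, conjTranspose_sum, ← Matrix.sum_mul, ← Matrix.mul_sum, ← Finset.smul_sum,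
      ← Nat.cast_smul_eq_nsmul ℂ]
    module
  rw [key]
  refine PosSemidef.smul ?_ (by positivity)
  exact posSemidef_sum _ fun i _ => posSemidef_sum _ fun j _ =>
    hB.conjTranspose_mul_mul_same _

theorem spectralProj_isHermitian {n : Type*} [Fintype n] [DecidableEq n]
    {A : Matrix n n ℂ} (hA : A.IsHermitian) (t : ℝ) :
    (spectralProj A hA t).IsHermitian := by
  refine isHermitian_mul_mul_conjTranspose _ (isHermitian_diagonal_of_self_adjoint _ ?_)
  ext i
  by_cases h : hA.eigenvalues i = t <;> simp [h]

theorem sum_spectralProj {n : Type*} [Fintype n] [DecidableEq n]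
    {A : Matrix n n ℂ} (hA : A.IsHermitian) :
    ∑ t ∈ Finset.univ.image hA.eigenvalues, spectralProj A hA t = 1 := by
  have hdiag : ∑ t ∈ Finset.univ.image hA.eigenvalues,
      diagonal (fun i => if hA.eigenvalues i = t then (1 : ℂ) else 0) = 1 := by
    ext i j
    by_cases h : i = j <;> simp [Matrix.sum_apply, Matrix.one_apply, h]
  simp only [spectralProj]
  rw [← Matrix.sum_mul, ← Matrix.mul_sum, hdiag, mul_one]
  exact Unitary.mul_star_self_of_mem hA.eigenvectorUnitary.2

/-- the pinching inequality `B ≤ ν_A · ℰ_A(B)` in the Löwner order. -/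
theorem pinching_inequality
    {n : Type*} [Fintype n] [DecidableEq n]
    (A B : Matrix n n ℂ) (hA : A.IsHermitian) (hB : B.PosSemidef) :
    ((nEig A : ℂ) • pinch A B - B).PosSemidef := by
  have h := hB.card_smul_sum_conj_sub_conj_sum (Finset.univ.image hA.eigenvalues)
    (spectralProj A hA)
  simpa only [nEig, pinch, dif_pos hA, sum_spectralProj, (spectralProj_isHermitian hA _).eq,
    conjTranspose_one, one_mul, mul_one] using h
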